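/- Let p be a prime with p ≡ 1 (mod 8). Then the 2-Sylow subgroup of the ideal class group of ℚ(√−p) is cyclic, and its order is divisible by 4; in particular 4 divides the class number of ℚ(√−p). -/

import Mathlib

open NumberField IntermediateField

/-- The imaginary quadratic field `k = ℚ(√-p) ⊂ ℂ`. -/
noncomputable def Qsqrtneg (p : ℕ) : IntermediateField ℚ ℂ := ℚ⟮(Complex.I * Real.sqrt p : ℂ)⟯

theorem exists_two_mul_sq_sub_sq_eq_prime {p : ℕ} (hp : p.Prime) (hp8 : p % 8 = 1) :
    ∃ a x : ℤ, 2 * a ^ 2 - x ^ 2 = p := by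
  have := Fact.mk hp
  have hpp : Prime (p : ℤ) := Nat.prime_iff_prime_int.mp hp
  obtain ⟨s, hs⟩ := (ZMod.exists_sq_eq_two_iff (p := p) (by omega)).mpr (Or.inl hp8)
  set k := Nat.sqrt p with hk
  have hk1 : p < (k + 1) * (k + 1) := Nat.lt_succ_sqrt p
  have hk2 : k * k < p := lt_of_le_of_ne (Nat.sqrt_le p) fun h ↦
    Irreducible.not_isSquare hp ⟨k, h.symm⟩
  obtain ⟨⟨i, j⟩, ⟨i', j'⟩, hne, heq⟩ :=
    Fintype.exists_ne_map_eq_of_card_lt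
      (fun q : Fin (k + 1) × Fin (k + 1) ↦ ((q.1 : ℕ) : ZMod p) - s * ((q.2 : ℕ) : ZMod p))
      (by simpa [ZMod.card] using hk1)
  have hsq (m n : Fin (k + 1)) : ((m : ℤ) - n) ^ 2 < p := by
    have h1 : |(m : ℤ) - n| ≤ k := by rw [abs_le]; omega
    have h2 : ((m : ℤ) - n) ^ 2 ≤ (k : ℤ) ^ 2 := sq_le_sq' (abs_le.mp h1).1 (abs_le.mp h1).2
    have h3 : (k : ℤ) * k < p := by exact_mod_cast hk2
    nlinarith
  have hu := hsq i i'
  have hv := hsq j j'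
  set u : ℤ := (i : ℤ) - i' with hudef
  set v : ℤ := (j : ℤ) - j' with hvdef
  have huv : (u : ZMod p) = s * v := by
    simp only [hudef, hvdef]
    push_cast
    linear_combination heq
  have hdvd : (p : ℤ) ∣ 2 * v ^ 2 - u ^ 2 := by
    rw [← ZMod.intCast_zmod_eq_zero_iff_dvd]
    push_cast
    rw [huv, hs]
    ring
  have hne0 : 2 * v ^ 2 - u ^ 2 ≠ 0 := by
    intro h0
    by_cases hv0 : v = 0
    · have hu0 : u = 0 := by simpa [hv0] using h0
      apply hne
      ext <;> simp <;> omega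
    · refine (irrational_sqrt_two.ne_rational |u| |v|) ?_
      have hv' : (0 : ℝ) < |(v : ℝ)| := by positivity
      have h0' : 2 * (v : ℝ) ^ 2 - (u : ℝ) ^ 2 = 0 := by exact_mod_cast h0
      push_cast
      rw [Real.sqrt_eq_iff_mul_self_eq_of_pos (by
        have : u ≠ 0 := by
          rintro hu0
          rw [hu0] at h0
          apply hv0
          simpa using h0
        positivity)]
      rw [div_mul_div_comm, abs_mul_abs_self, abs_mul_abs_self]
      field_simp
      linarith
  obtain ⟨m, hm⟩ := hdvd
  have hp0 : (0 : ℤ) < p := by exact_mod_cast hp.pos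
  have hm1 : m < 2 := by
    by_contra! h
    nlinarith [sq_nonneg u]
  have hm2 : -1 < m := by
    by_contra! h
    nlinarith [sq_nonneg v]
  have hm0 : m ≠ 0 := by
    rintro rfl
    exact hne0 (by simpa using hm)
  obtain rfl : m = 1 := by omega
  exact ⟨v, u, by simpa using hm⟩

theorem card_filter_pow_two_pow_eq_one_le {G : Type*} [CommGroup G] [Fintype G] [DecidableEq G]
    {t : G} (ht : ∀ c : G, c ^ 2 = 1 → c = 1 ∨ c = t) (k : ℕ) :
    (Finset.univ.filter fun g : G ↦ g ^ 2 ^ k = 1).card ≤ 2 ^ k := by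
  induction k with
  | zero => simp [Finset.card_le_one]
  | succ k ih =>
    refine (Finset.card_le_mul_card_image_of_maps_to (f := fun g : G ↦ g ^ 2)
      (t := Finset.univ.filter fun g : G ↦ g ^ 2 ^ k = 1) ?_ 2 ?_).trans ?_
    · intro g hg
      simpa [← pow_mul, ← pow_succ'] using hg
    · intro b _
      rcases Finset.eq_empty_or_nonempty
        {a ∈ Finset.univ.filter fun g : G ↦ g ^ 2 ^ (k + 1) = 1 | a ^ 2 = b} with h | ⟨a, ha⟩
      · simp [h]
      · refine (Finset.card_le_card (t := {a, a * t}) ?_).trans Finset.card_le_two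
        intro c hc
        simp only [Finset.mem_filter, Finset.mem_univ, true_and] at ha hc
        have : (a⁻¹ * c) ^ 2 = 1 := by rw [mul_pow, inv_pow, ha.2, hc.2, inv_mul_cancel]
        rcases ht _ this with h | h
        · simp [(inv_mul_eq_one.mp h).symm]
        · simp [← h]
    · rw [pow_succ']
      exact Nat.mul_le_mul_left 2 ih

theorem IsPGroup.isCyclic_of_sq_eq_one {G : Type*} [CommGroup G] [Finite G] (hG : IsPGroup 2 G)
    {t : G} (ht : ∀ c : G, c ^ 2 = 1 → c = 1 ∨ c = t) : IsCyclic G := by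
  classical
  have := Fintype.ofFinite G
  refine isCyclic_of_card_pow_eq_one_le fun n hn ↦ ?_
  obtain ⟨k, m, hm, rfl⟩ := Nat.exists_eq_two_pow_mul_odd hn.ne'
  refine (Finset.card_le_card (t := Finset.univ.filter fun g : G ↦ g ^ 2 ^ k = 1) ?_).trans
    ((card_filter_pow_two_pow_eq_one_le ht k).trans (Nat.le_mul_of_pos_right _ hm.pos))
  intro g hg
  simp only [Finset.mem_filter, Finset.mem_univ, true_and] at hg ⊢
  obtain ⟨l, hl⟩ := hG g
  have h1 : orderOf g ∣ 2 ^ k * m := orderOf_dvd_of_pow_eq_one hg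
  have h2 : orderOf g ∣ 2 ^ l := orderOf_dvd_of_pow_eq_one hl
  have h3 : Nat.Coprime (orderOf g) m :=
    Nat.Coprime.coprime_dvd_left h2 (Nat.Coprime.pow_left l hm.coprime_two_left)
  exact orderOf_dvd_iff_pow_eq_one.mp (h3.dvd_of_dvd_mul_right h1)

theorem sylow_two_isCyclic_and_four_dvd_card {G : Type*} [CommGroup G] [Finite G] {s t : G}
    (ht : ∀ c : G, c ^ 2 = 1 → c = 1 ∨ c = t) (ht1 : t ≠ 1) (ht2 : t ^ 2 = 1)
    (hs : s ^ 2 * t = 1) (P : Sylow 2 G) : IsCyclic P ∧ 4 ∣ Nat.card P := by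
  constructor
  · by_cases htP : t ∈ P
    · refine P.isPGroup'.isCyclic_of_sq_eq_one (t := ⟨t, htP⟩) fun c hc ↦ ?_
      exact (ht c (congrArg Subtype.val hc)).imp (fun h ↦ Subtype.ext h) fun h ↦ Subtype.ext h
    · refine P.isPGroup'.isCyclic_of_sq_eq_one (t := 1) fun c hc ↦ Or.inl ?_
      rcases ht c (congrArg Subtype.val hc) with h | h
      · exact Subtype.ext h
      · exact absurd (h ▸ c.2) htP
  · have hst : s ^ 2 = t := by
      rw [mul_eq_one_iff_eq_inv.mp hs, inv_eq_iff_mul_eq_one, ← sq, ht2]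
    have ho : orderOf s = 2 ^ (1 + 1) :=
      orderOf_eq_prime_pow (by simpa [hst] using ht1) (by
        rw [pow_succ, pow_mul, pow_one, hst, ht2])
    have h4 : 2 ^ 2 ∣ Nat.card G := by
      have := orderOf_dvd_natCard s
      rwa [ho] at this
    exact P.pow_dvd_card_of_pow_dvd_card h4
/-- If the sum and product of conjugates `w`, `v` satisfy the coprimality condition of a primitive
binary form, the ideals `(a, w)` and `(a, v)` are inverse to each other up to `(a)`. -/
theorem Ideal.span_pair_mul_span_pair_eq_span_singleton {R : Type*} [CommRing R]
    {a w v c u₁ u₂ u₃ : R} (hwv : w * v = a * c) (h : u₁ * a + u₂ * (w + v) + u₃ * c = 1) :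
    Ideal.span {a, w} * Ideal.span {a, v} = Ideal.span {a} := by
  rw [Ideal.span_pair_mul_span_pair]
  apply le_antisymm
  · rw [Ideal.span_le]
    rintro y (rfl | rfl | rfl | rfl) <;>
      simp only [SetLike.mem_coe, Ideal.mem_span_singleton]
    · exact dvd_mul_left _ _
    · exact dvd_mul_right _ _
    · exact dvd_mul_left _ _
    · exact ⟨c, hwv⟩
  · rw [Ideal.span_singleton_le_iff_mem]
    set I := Ideal.span {a * a, a * v, w * a, w * v}
    have h1 : a * a ∈ I := Ideal.subset_span (by simp)
    have h2 : a * v ∈ I := Ideal.subset_span (by simp)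
    have h3 : w * a ∈ I := Ideal.subset_span (by simp)
    have h4 : w * v ∈ I := Ideal.subset_span (by simp)
    have := I.add_mem (I.add_mem (I.mul_mem_left u₁ h1) (I.mul_mem_left u₂ (I.add_mem h2 h3)))
      (I.mul_mem_left u₃ h4)
    convert this using 1
    linear_combination (-a) * h - u₃ * hwv

theorem Ideal.span_pair_sq_mul_span_pair_eq_span_singleton {R : Type*} [CommRing R]
    {a w v x u₁ u₂ : R} (hwv : w * v = 2 * a ^ 2) (hx : w + v = 2 * x)
    (h : u₁ * a ^ 2 + u₂ * (4 * x) = 1) :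
    Ideal.span {a, w} ^ 2 * Ideal.span {2, w} = Ideal.span {w} := by
  rw [sq, Ideal.span_pair_mul_span_pair]
  apply le_antisymm
  · rw [Ideal.mul_le]
    intro y hy z hz
    have hz' : ∃ s t, s * 2 + t * w = z := Ideal.mem_span_pair.mp hz
    obtain ⟨s, t, rfl⟩ := hz'
    rw [Ideal.mem_span_singleton]
    suffices H : w ∣ y * 2 by
      obtain ⟨q, hq⟩ := H
      exact ⟨q * s + y * t, by linear_combination s * hq⟩
    have : Ideal.span {a * a, a * w, w * a, w * w} ≤
        Submodule.comap (LinearMap.mulRight R (2 : R)) (Ideal.span {w}) := by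
      rw [Ideal.span_le]
      rintro y (rfl | rfl | rfl | rfl) <;>
        simp only [SetLike.mem_coe, Submodule.mem_comap, LinearMap.mulRight_apply,
          Ideal.mem_span_singleton]
      · exact ⟨v, by linear_combination -hwv⟩
      · exact ⟨a * 2, by ring⟩
      · exact ⟨a * 2, by ring⟩
      · exact ⟨w * 2, by ring⟩
    simpa [Ideal.mem_span_singleton] using this hy
  · rw [Ideal.span_singleton_le_iff_mem]
    set I := Ideal.span {a * a, a * w, w * a, w * w}
    set J := Ideal.span {2, w}
    have h1 : a * a ∈ I := Ideal.subset_span (by simp)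
    have h4 : w * w ∈ I := Ideal.subset_span (by simp)
    have h2 : (2 : R) ∈ J := Ideal.subset_span (by simp)
    have h3 : w ∈ J := Ideal.subset_span (by simp)
    have := (I * J).add_mem ((I * J).mul_mem_left u₁ (Ideal.mul_mem_mul h1 h3))
      ((I * J).mul_mem_left u₂ ((I * J).add_mem (Ideal.mul_mem_mul h4 h2)
        ((I * J).mul_mem_left 2 (Ideal.mul_mem_mul h1 h2))))
    convert this using 1
    linear_combination (-w) * h + u₂ * 2 * hwv - 2 * u₂ * w * hx

namespace Zsqrtd

theorem exists_eq_span_singleton_mul_span_pair {d : ℤ} (hd : d < 0) {I : Ideal (ℤ√d)}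
    (hI : I ≠ ⊥) :
    ∃ e a b c : ℤ, e ≠ 0 ∧ a ≠ 0 ∧ b ^ 2 - d = a * c ∧
      I = Ideal.span {(e : ℤ√d)} * Ideal.span {(a : ℤ√d), ⟨b, 1⟩} := by
  obtain ⟨z, hzI, hz⟩ := Submodule.exists_mem_ne_zero_of_ne_bot hI
  let E : Ideal ℤ :=
    { carrier := {n | ∃ m, (⟨m, n⟩ : ℤ√d) ∈ I}
      add_mem' := by
        rintro _ _ ⟨m, hm⟩ ⟨m', hm'⟩
        exact ⟨m + m', I.add_mem hm hm'⟩
      zero_mem' := ⟨0, I.zero_mem⟩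
      smul_mem' := by
        rintro k _ ⟨m, hm⟩
        exact ⟨k * m, by simpa [smul_val] using I.mul_mem_left (k : ℤ√d) hm⟩ }
  have hE (n : ℤ) : n ∈ E ↔ ∃ m, (⟨m, n⟩ : ℤ√d) ∈ I := Iff.rfl
  obtain ⟨e, he⟩ := (IsPrincipalIdealRing.principal E).principal
  obtain ⟨g, hg⟩ := (IsPrincipalIdealRing.principal (I.comap (Int.castRingHom (ℤ√d)))).principal
  have hE' (n : ℤ) : e ∣ n ↔ ∃ m, (⟨m, n⟩ : ℤ√d) ∈ I := by
    rw [← hE, he, Ideal.submodule_span_eq, Ideal.mem_span_singleton]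
  have hg' (n : ℤ) : g ∣ n ↔ (n : ℤ√d) ∈ I := by
    rw [← Ideal.mem_span_singleton, ← Ideal.submodule_span_eq, ← hg, Ideal.mem_comap,
      eq_intCast]
  obtain ⟨b₀, hb₀⟩ := (hE' e).mp dvd_rfl
  have hgI := (hg' g).mp dvd_rfl
  have hzn : g ∣ z.norm := by
    rw [hg', norm_eq_mul_conj]
    exact I.mul_mem_right _ hzI
  have hg0 : g ≠ 0 := by
    rintro rfl
    exact hz ((norm_eq_zero_iff hd z).mp (zero_dvd_iff.mp hzn))
  obtain ⟨a, ha⟩ : e ∣ g := by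
    rw [hE']
    refine ⟨0, ?_⟩
    have := I.mul_mem_left (⟨0, 1⟩ : ℤ√d) hgI
    convert this using 1
    ext <;> simp
  obtain ⟨b, hb⟩ : e ∣ b₀ := by
    rw [hE']
    refine ⟨d * e, ?_⟩
    have := I.mul_mem_left (⟨0, 1⟩ : ℤ√d) hb₀
    convert this using 1
    ext <;> simp
  have he0 : e ≠ 0 := by
    rintro rfl
    exact hg0 (by simpa using ha)
  have hc : g ∣ e * (b ^ 2 - d) := by
    rw [hg', sq]
    have := I.mul_mem_left (⟨b, -1⟩ : ℤ√d) hb₀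
    convert this using 1
    ext <;> simp [hb] <;> ring
  obtain ⟨c, hc⟩ := hc
  refine ⟨e, a, b, c, he0, ?_, ?_, ?_⟩
  · rintro rfl
    exact hg0 (by simpa using ha)
  · apply mul_left_cancel₀ he0
    rw [hc, ha]
    ring
  · rw [Ideal.span_mul_span', Set.singleton_mul, Set.image_pair]
    apply _root_.le_antisymm
    · rintro ⟨x, y⟩ hxy
      obtain ⟨q, hq⟩ := (hE' y).mpr ⟨x, hxy⟩
      have h1 : g ∣ x - q * b₀ := by
        rw [hg']
        have := I.sub_mem hxy (I.mul_mem_left (q : ℤ√d) hb₀)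
        convert this using 1
        ext
        · simp
        · simp [hq]; ring
      obtain ⟨r, hr⟩ := h1
      rw [Ideal.mem_span_pair]
      refine ⟨r, q, ?_⟩
      ext
      · simp
        linear_combination -hr - r * ha - q * hb
      · simp [hq]; ring
    · rw [Ideal.span_le]
      rintro y (rfl | rfl)
      · rw [ha] at hgI
        simpa using hgI
      · have : (e : ℤ√d) * ⟨b, 1⟩ = ⟨b₀, e⟩ := by ext <;> simp [hb]
        rwa [this]

theorem mem_span_pair_iff {d a b c : ℤ} (h : b ^ 2 - d = a * c) (z : ℤ√d) :
    z ∈ Ideal.span {(a : ℤ√d), ⟨b, 1⟩} ↔ a ∣ z.re - b * z.im := by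
  rw [Ideal.mem_span_pair]
  constructor
  · rintro ⟨u, v, rfl⟩
    refine ⟨u.re - b * u.im - c * v.im, ?_⟩
    simp
    linear_combination (-v.im) * h
  · rintro ⟨q, hq⟩
    refine ⟨q, z.im, ?_⟩
    ext
    · simp
      linear_combination -hq
    · simp

theorem map_star_span_pair {d : ℤ} (a b : ℤ) :
    (Ideal.span {(a : ℤ√d), ⟨b, 1⟩}).map (starRingEnd (ℤ√d)) =
      Ideal.span {(a : ℤ√d), ⟨b, -1⟩} := by
  rw [Ideal.map_span, Set.image_pair]
  simp [starRingEnd_apply, star_mk]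

theorem exists_bezout_of_sq_add_prime {p : ℕ} (hp : p.Prime) (hp4 : p % 4 = 1) {a b c : ℤ}
    (h : b ^ 2 + p = a * c) : ∃ u₁ u₂ u₃ : ℤ, u₁ * a + u₂ * (2 * b) + u₃ * c = 1 := by
  have key : Int.gcd a (Int.gcd (2 * b) c) = 1 := by
    rw [Nat.eq_one_iff_not_exists_prime_dvd]
    intro q hq hqd
    have hq' : Prime (q : ℤ) := Nat.prime_iff_prime_int.mp hq
    obtain ⟨ha, hbc⟩ := Int.dvd_gcd_iff.mp hqd
    obtain ⟨hb, hc⟩ := Int.dvd_coe_gcd_iff.mp hbc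
    have hac : (q : ℤ) * q ∣ b ^ 2 + p := h ▸ mul_dvd_mul ha hc
    by_cases hqb : (q : ℤ) ∣ b
    · have hqp : (q : ℤ) * q ∣ p :=
        (dvd_add_right (by rw [sq]; exact mul_dvd_mul hqb hqb)).mp hac
      have hqp' : q * q ∣ p := by exact_mod_cast hqp
      exact Nat.squarefree_iff_prime_squarefree.mp hp.prime.squarefree q hq hqp'
    · have hq2 : q = 2 := by
        have : (q : ℤ) ∣ 2 := (hq'.dvd_or_dvd hb).resolve_right hqb
        exact (Nat.prime_dvd_prime_iff_eq hq Nat.prime_two).mp (by exact_mod_cast this)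
      subst hq2
      obtain ⟨k, hk⟩ : Odd b := by
        rw [← Int.not_even_iff_odd, even_iff_two_dvd]
        exact_mod_cast hqb
      have h4 : (4 : ℤ) ∣ b ^ 2 + p := by simpa using hac
      have : b ^ 2 + p = 4 * (k ^ 2 + k) + 1 + p := by rw [hk]; ring
      omega
  have h1 := Int.gcd_eq_gcd_ab a (Int.gcd (2 * b) c)
  have h2 := Int.gcd_eq_gcd_ab (2 * b) c
  rw [key] at h1
  set r := Int.gcdB a (Int.gcd (2 * b) c)
  refine ⟨Int.gcdA a (Int.gcd (2 * b) c), r * Int.gcdA (2 * b) c, r * Int.gcdB (2 * b) c, ?_⟩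
  push_cast at h1
  linear_combination -h1 - r * h2

theorem exists_mul_map_star_eq_span_singleton {p : ℕ} (hp : p.Prime) (hp4 : p % 4 = 1)
    {I : Ideal (ℤ√(-(p : ℤ)))} (hI : I ≠ ⊥) :
    ∃ n : ℤ, I * I.map (starRingEnd (ℤ√(-(p : ℤ)))) = Ideal.span {(n : ℤ√(-(p : ℤ)))} := by
  obtain ⟨e, a, b, c, -, -, h, rfl⟩ :=
    exists_eq_span_singleton_mul_span_pair (by simpa using hp.pos) hI
  rw [sub_neg_eq_add] at h
  obtain ⟨u₁, u₂, u₃, hu⟩ := exists_bezout_of_sq_add_prime hp hp4 h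
  refine ⟨e * e * a, ?_⟩
  rw [Ideal.map_mul, map_star_span_pair, Ideal.map_span, Set.image_singleton, map_intCast,
    mul_mul_mul_comm, Ideal.span_singleton_mul_span_singleton,
    Ideal.span_pair_mul_span_pair_eq_span_singleton (c := (c : ℤ√(-(p : ℤ))))
      (u₁ := (u₁ : ℤ√(-(p : ℤ)))) (u₂ := (u₂ : ℤ√(-(p : ℤ)))) (u₃ := (u₃ : ℤ√(-(p : ℤ))))]
  · rw [Ideal.span_singleton_mul_span_singleton]
    push_cast
    rfl
  · ext
    · simp
      linear_combination h
    · simp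
  · ext
    · simp
      linear_combination hu
    · simp

theorem span_pair_congr {d a a' b b' : ℤ} (ha : a.natAbs = a'.natAbs) (hb : a ∣ b - b') :
    Ideal.span {(a : ℤ√d), ⟨b, 1⟩} = Ideal.span {(a' : ℤ√d), ⟨b', 1⟩} := by
  obtain ⟨q, hq⟩ := hb
  have h1 : (⟨b, 1⟩ : ℤ√d) = ⟨b', 1⟩ + q * a := by
    ext
    · simp
      linear_combination hq
    · simp
  rw [h1, Ideal.span_pair_add_mul_left]
  rcases Int.natAbs_eq_natAbs_iff.mp ha with rfl | rfl
  · rfl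
  · rw [Ideal.span_insert, Ideal.span_insert]
    rw [Int.cast_neg, Ideal.span_singleton_neg]

theorem exists_eq_span_singleton_mul_of_map_star_eq {p : ℕ} [IsDomain (ℤ√(-(p : ℤ)))]
    (hp : p.Prime) {I : Ideal (ℤ√(-(p : ℤ)))} (hI : I ≠ ⊥)
    (h : I.map (starRingEnd (ℤ√(-(p : ℤ)))) = I) :
    ∃ x : ℤ√(-(p : ℤ)), x ≠ 0 ∧
      (I = Ideal.span {x} ∨ I = Ideal.span {x} * Ideal.span {2, ⟨1, 1⟩}) := by
  obtain ⟨e, a, b, c, he, ha, habc, rfl⟩ :=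
    exists_eq_span_singleton_mul_span_pair (by simpa using hp.pos) hI
  have he' : (e : ℤ√(-(p : ℤ))) ≠ 0 := by exact_mod_cast he
  rw [Ideal.map_mul, map_star_span_pair, Ideal.map_span, Set.image_singleton, map_intCast,
    Ideal.span_singleton_mul_right_inj he'] at h
  have hab : a ∣ 2 * b := by
    have : (⟨b, -1⟩ : ℤ√(-(p : ℤ))) ∈ Ideal.span {(a : ℤ√(-(p : ℤ))), ⟨b, 1⟩} := by
      rw [← h]
      exact Ideal.subset_span (by simp)
    rw [mem_span_pair_iff habc] at this
    convert this using 1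
    simp
    ring
  rw [sub_neg_eq_add] at habc
  suffices H : ∃ x : ℤ√(-(p : ℤ)), x ≠ 0 ∧
      (Ideal.span {(a : ℤ√(-(p : ℤ))), ⟨b, 1⟩} = Ideal.span {x} ∨
        Ideal.span {(a : ℤ√(-(p : ℤ))), ⟨b, 1⟩} = Ideal.span {x} * Ideal.span {2, ⟨1, 1⟩}) by
    obtain ⟨x, hx, H⟩ := H
    refine ⟨e * x, mul_ne_zero he' hx, ?_⟩
    rw [← Ideal.span_singleton_mul_span_singleton, mul_assoc]
    exact H.imp (fun H ↦ by rw [H]) fun H ↦ by rw [H]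
  have natAbs_of_dvd {m : ℤ} (hm : m ∣ p) : m.natAbs = 1 ∨ m.natAbs = p :=
    (Nat.dvd_prime hp).mp (by simpa using Int.natAbs_dvd_natAbs.mpr hm)
  have hsqrtd : (⟨0, 1⟩ : ℤ√(-(p : ℤ))) ≠ 0 := by simp [Zsqrtd.ext_iff]
  obtain ⟨q, hq⟩ := hab
  rcases Int.even_or_odd' q with ⟨k, rfl | rfl⟩
  · have hbk : b = a * k := by linarith
    have hap : a ∣ p := ⟨c - a * k ^ 2, by rw [hbk] at habc; linear_combination habc⟩
    rcases natAbs_of_dvd hap with h1 | h1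
    · refine ⟨1, one_ne_zero, Or.inl ?_⟩
      rw [Ideal.span_singleton_one, Ideal.eq_top_iff_one]
      refine Ideal.mem_span_pair.mpr ⟨a, 0, ?_⟩
      have : a * a = 1 := by
        rw [← Int.natAbs_mul_self, h1]
        rfl
      rw [zero_mul, add_zero]
      exact_mod_cast this
    · refine ⟨⟨0, 1⟩, hsqrtd, Or.inl ?_⟩
      rw [span_pair_congr (a' := p) (b' := 0) (by simpa using h1) ⟨k, by linarith⟩]
      apply _root_.le_antisymm
      · rw [Ideal.span_le]
        rintro y (rfl | rfl)
        · refine Ideal.mem_span_singleton.mpr ⟨⟨0, -1⟩, ?_⟩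
          ext <;> simp
        · exact Ideal.mem_span_singleton_self _
      · exact Ideal.span_mono (by simp)
  · obtain ⟨m, rfl⟩ : (2 : ℤ) ∣ a := by
      have : Even (a * (2 * k + 1)) := ⟨b, by linarith⟩
      rw [Int.even_mul] at this
      exact (this.resolve_right (by simp [parity_simps])).two_dvd
    have hbm : b = m * (2 * k + 1) := by linarith
    have hmp : m ∣ p :=
      ⟨2 * c - m * (2 * k + 1) ^ 2, by rw [hbm] at habc; linear_combination habc⟩
    rcases natAbs_of_dvd hmp with h1 | h1
    · refine ⟨1, one_ne_zero, Or.inr ?_⟩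
      rw [span_pair_congr (a' := 2) (b' := 1) (by rw [Int.natAbs_mul, h1]; rfl),
        Ideal.span_singleton_one, Ideal.top_mul]
      · rfl
      · rcases Int.natAbs_eq_iff.mp h1 with rfl | rfl
        · exact ⟨k, by rw [hbm]; push_cast; ring⟩
        · exact ⟨k + 1, by rw [hbm]; push_cast; ring⟩
    · refine ⟨⟨0, 1⟩, hsqrtd, Or.inr ?_⟩
      rw [span_pair_congr (a' := 2 * p) (b' := -p) (by rw [Int.natAbs_mul, h1]; rfl),
        Ideal.span_mul_span', Set.singleton_mul, Set.image_pair]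
      · apply _root_.le_antisymm
        · rw [Ideal.span_le]
          rintro y (rfl | rfl)
          · refine Ideal.mem_span_pair.mpr ⟨1, -2, ?_⟩
            ext <;> simp
          · refine Ideal.mem_span_pair.mpr ⟨0, 1, ?_⟩
            ext <;> simp
        · rw [Ideal.span_le]
          rintro y (rfl | rfl)
          · refine Ideal.mem_span_pair.mpr ⟨1, 2, ?_⟩
            ext <;> simp
          · refine Ideal.mem_span_pair.mpr ⟨0, 1, ?_⟩
            ext <;> simp
      · rcases Int.natAbs_eq_iff.mp h1 with rfl | rfl
        · exact ⟨k + 1, by rw [hbm]; ring⟩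
        · exact ⟨k, by rw [hbm]; ring⟩

theorem span_two_sq {p : ℕ} (hp4 : p % 4 = 1) :
    Ideal.span {(2 : ℤ√(-(p : ℤ))), ⟨1, 1⟩} ^ 2 = Ideal.span {2} := by
  obtain ⟨k, hk⟩ : ∃ k : ℤ, (p : ℤ) = 4 * k + 1 := ⟨p / 4, by omega⟩
  have h2 : (2 : ℤ√(-(p : ℤ))) = ((2 : ℤ) : ℤ√(-(p : ℤ))) := rfl
  rw [sq, Ideal.span_pair_mul_span_pair]
  apply _root_.le_antisymm
  · rw [Ideal.span_le]
    rintro y (rfl | rfl | rfl | rfl) <;>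
      simp only [SetLike.mem_coe, Ideal.mem_span_singleton]
    · exact dvd_mul_right _ _
    · exact dvd_mul_right _ _
    · exact dvd_mul_left _ _
    · rw [h2, intCast_dvd]
      simp
      omega
  · rw [Ideal.span_singleton_le_iff_mem]
    set I := Ideal.span {(2 : ℤ√(-(p : ℤ))) * 2, 2 * ⟨1, 1⟩, ⟨1, 1⟩ * 2, ⟨1, 1⟩ * ⟨1, 1⟩}
    have h1 : (2 : ℤ√(-(p : ℤ))) * 2 ∈ I := Ideal.subset_span (by simp)
    have h2 : (2 : ℤ√(-(p : ℤ))) * ⟨1, 1⟩ ∈ I := Ideal.subset_span (by simp)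
    have h3 : (⟨1, 1⟩ : ℤ√(-(p : ℤ))) * ⟨1, 1⟩ ∈ I := Ideal.subset_span (by simp)
    convert I.sub_mem (I.sub_mem h2 h3) (I.mul_mem_left (k : ℤ√(-(p : ℤ))) h1) using 1
    ext
    · simp
      linarith
    · simp

theorem not_isPrincipal_span_two {p : ℕ} (hp : p.Prime) (hp8 : p % 8 = 1) :
    ¬ (Ideal.span {(2 : ℤ√(-(p : ℤ))), ⟨1, 1⟩}).IsPrincipal := by
  rintro ⟨x, hx⟩
  rw [Ideal.submodule_span_eq] at hx
  have hp1 := hp.one_lt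
  have h1 : x ∣ 2 := by
    rw [← Ideal.mem_span_singleton, ← hx]
    exact Ideal.subset_span (by simp)
  have h2 : x ∣ ⟨1, 1⟩ := by
    rw [← Ideal.mem_span_singleton, ← hx]
    exact Ideal.subset_span (by simp)
  have h3 : x ∈ Ideal.span {((2 : ℤ) : ℤ√(-(p : ℤ))), ⟨1, 1⟩} := by
    have : x ∈ Ideal.span {(2 : ℤ√(-(p : ℤ))), ⟨1, 1⟩} := hx ▸ Ideal.mem_span_singleton_self x
    simpa using this
  obtain ⟨k, hk⟩ : ∃ k : ℤ, (p : ℤ) = 8 * k + 1 := ⟨p / 8, by omega⟩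
  rw [mem_span_pair_iff (c := 4 * k + 1) (by rw [hk]; ring)] at h3
  have n1 : x.norm ∣ 4 := by
    obtain ⟨y, hy⟩ := h1
    refine ⟨y.norm, ?_⟩
    rw [← norm_mul, ← hy]
    exact (norm_intCast 2).symm
  have n2 : x.norm ∣ 8 * k + 2 := by
    obtain ⟨y, hy⟩ := h2
    refine ⟨y.norm, ?_⟩
    rw [← norm_mul, ← hy]
    simp [norm_def]
    linarith
  have n3 : x.norm ∣ 2 := by
    have := dvd_sub n2 (n1.mul_right (2 * k))
    rwa [show 8 * k + 2 - 4 * (2 * k) = 2 by ring] at this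
  have n4 := Int.le_of_dvd two_pos n3
  rw [norm_def] at n4
  have him : x.im = 0 := by
    by_contra him
    have : 0 < x.im * x.im := mul_self_pos.mpr him
    have hp17 : (3 : ℤ) ≤ p := by omega
    nlinarith [mul_self_nonneg x.re]
  rw [him] at n4 h3
  obtain ⟨r, hr⟩ := h3
  have hr0 : r = 0 := by
    have : x.re = 2 * r := by linarith
    rw [this] at n4
    by_contra hr0
    have : 0 < r * r := mul_self_pos.mpr hr0
    nlinarith
  have hx0 : x = 0 := by
    ext
    · simp only [re_zero]
      linarith
    · exact him
  rw [hx0, zero_dvd_iff] at h1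
  exact two_ne_zero h1

theorem exists_span_sq_mul_span_two_eq {p : ℕ} (hp : p.Prime) (hp8 : p % 8 = 1) :
    ∃ a x : ℤ, a ≠ 0 ∧ Ideal.span {(a : ℤ√(-(p : ℤ))), ⟨x, 1⟩} ^ 2 *
      Ideal.span {(2 : ℤ√(-(p : ℤ))), ⟨1, 1⟩} = Ideal.span {⟨x, 1⟩} := by
  obtain ⟨a, x, hax⟩ := exists_two_mul_sq_sub_sq_eq_prime hp hp8
  obtain ⟨k, hk⟩ : ∃ k : ℤ, (p : ℤ) = 8 * k + 1 := ⟨p / 8, by omega⟩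
  have hx : Odd x := by
    have : ¬ Even (x ^ 2) := by
      rintro ⟨m, hm⟩
      omega
    rw [Int.even_pow' two_ne_zero] at this
    exact Int.not_even_iff_odd.mp this
  obtain ⟨m, hm⟩ := hx
  have ha : Odd a := by
    rw [← Int.not_even_iff_odd]
    rintro ⟨n, rfl⟩
    have : 8 * n ^ 2 - (4 * (m ^ 2 + m) + 1) = 8 * k + 1 := by
      rw [← hk, ← hax, hm]
      ring
    omega
  have hcop : IsCoprime a x := by
    rw [Int.isCoprime_iff_gcd_eq_one, Nat.eq_one_iff_not_exists_prime_dvd]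
    intro q hq hqd
    obtain ⟨ha, hx⟩ := Int.dvd_gcd_iff.mp hqd
    have hqp : (q : ℤ) * q ∣ p := by
      rw [← hax, sq, sq]
      exact dvd_sub ((mul_dvd_mul ha ha).mul_left 2) (mul_dvd_mul hx hx)
    exact Nat.squarefree_iff_prime_squarefree.mp hp.prime.squarefree q hq (by exact_mod_cast hqp)
  have hcop' : IsCoprime (a ^ 2) (4 * x) := by
    refine IsCoprime.pow_left (IsCoprime.mul_right ?_ hcop)
    have : IsCoprime a ((2 : ℤ) ^ 2) := (Int.isCoprime_two_right.mpr ha).pow_right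
    simpa using this
  obtain ⟨u₁, u₂, hu⟩ := hcop'
  refine ⟨a, x, ?_, ?_⟩
  · rintro rfl
    simp at ha
  · have h21 : Ideal.span {(2 : ℤ√(-(p : ℤ))), ⟨1, 1⟩} = Ideal.span {2, ⟨x, 1⟩} :=
      span_pair_congr (a := 2) (a' := 2) rfl ⟨-m, by rw [hm]; ring⟩
    rw [h21]
    refine Ideal.span_pair_sq_mul_span_pair_eq_span_singleton (v := ⟨x, -1⟩)
      (x := (x : ℤ√(-(p : ℤ)))) (u₁ := (u₁ : ℤ√(-(p : ℤ)))) (u₂ := (u₂ : ℤ√(-(p : ℤ)))) ?_ ?_ ?_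
    · rw [sq]
      ext
      · simp
        linarith
      · simp
    · ext <;> simp
      ring
    · exact_mod_cast hu

theorem eq_or_exists_of_sq_eq_span_singleton {p : ℕ} [IsDedekindDomain (ℤ√(-(p : ℤ)))]
    (hp : p.Prime) (hp4 : p % 4 = 1) {I : Ideal (ℤ√(-(p : ℤ)))} (hI : I ≠ ⊥)
    (hsq : (I ^ 2).IsPrincipal) :
    ∃ x y : ℤ√(-(p : ℤ)), x ≠ 0 ∧ y ≠ 0 ∧ (Ideal.span {y} * I = Ideal.span {x} ∨
      Ideal.span {y} * I = Ideal.span {x} * Ideal.span {2, ⟨1, 1⟩}) := by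
  set σ := starRingEnd (ℤ√(-(p : ℤ))) with hσ
  have hd : -(p : ℤ) < 0 := by simpa using hp.pos
  suffices H : ∃ γ : ℤ√(-(p : ℤ)), γ ≠ 0 ∧
      (Ideal.span {γ} * I).map σ = Ideal.span {γ} * I by
    obtain ⟨γ, hγ, H⟩ := H
    have : Ideal.span {γ} * I ≠ ⊥ := by
      simpa [Ideal.mul_eq_bot, Ideal.span_singleton_eq_bot] using ⟨hγ, hI⟩
    obtain ⟨x, hx, h⟩ := exists_eq_span_singleton_mul_of_map_star_eq hp this H
    exact ⟨x, γ, hx, hγ, h⟩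
  obtain ⟨α, hα⟩ := hsq
  rw [Ideal.submodule_span_eq] at hα
  obtain ⟨n, hn⟩ := exists_mul_map_star_eq_span_singleton hp hp4 hI
  have hσα : (I.map σ) ^ 2 = Ideal.span {star α} := by
    rw [← Ideal.map_pow, hα, Ideal.map_span, Set.image_singleton, hσ, starRingEnd_apply]
  have hnorm : α.norm = n ^ 2 := by
    have h1 : Ideal.span {((α.norm : ℤ) : ℤ√(-(p : ℤ)))} =
        Ideal.span {((n ^ 2 : ℤ) : ℤ√(-(p : ℤ)))} := by
      rw [norm_eq_mul_conj, ← Ideal.span_singleton_mul_span_singleton, ← hα, ← hσα, ← mul_pow, hn,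
        Ideal.span_singleton_pow]
      push_cast
      rfl
    have h2 := Ideal.span_singleton_le_span_singleton.mp h1.le
    have h3 := Ideal.span_singleton_le_span_singleton.mp h1.ge
    rw [intCast_dvd_intCast] at h2 h3
    exact Int.dvd_antisymm (norm_nonneg hd.le α) (sq_nonneg n) h3 h2
  have hnorm' : α * star α = n ^ 2 := by
    rw [← norm_eq_mul_conj, hnorm]
    push_cast
    rfl
  by_cases hαn : α + n = 0
  · refine ⟨1, one_ne_zero, ?_⟩
    rw [Ideal.span_singleton_one, Ideal.top_mul]
    apply mul_left_cancel₀ hI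
    rw [hn, ← sq, hα, eq_neg_of_add_eq_zero_left hαn, Ideal.span_singleton_neg]
  · refine ⟨star (α + n), star_ne_zero.mpr hαn, ?_⟩
    rw [Ideal.map_mul, Ideal.map_span, Set.image_singleton, hσ, starRingEnd_apply, star_star, ← hσ]
    apply mul_left_cancel₀ hI
    calc I * (Ideal.span {α + n} * I.map σ) = Ideal.span {α + n} * (I * I.map σ) := by ring
      _ = Ideal.span {star (α + n)} * I ^ 2 := by
        rw [hn, hα, Ideal.span_singleton_mul_span_singleton, Ideal.span_singleton_mul_span_singleton]
        congr 2
        rw [star_add, star_intCast]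
        linear_combination -hnorm'
      _ = I * (Ideal.span {star (α + n)} * I) := by ring

theorem exists_classGroup_structure {p : ℕ} [IsDedekindDomain (ℤ√(-(p : ℤ)))]
    (hp : p.Prime) (hp8 : p % 8 = 1) :
    ∃ s t : ClassGroup (ℤ√(-(p : ℤ))), (∀ c : ClassGroup (ℤ√(-(p : ℤ))), c ^ 2 = 1 → c = 1 ∨ c = t) ∧
      t ≠ 1 ∧ t ^ 2 = 1 ∧ s ^ 2 * t = 1 := by
  have hp4 : p % 4 = 1 := by omega
  obtain ⟨a, x, ha, hax⟩ := exists_span_sq_mul_span_two_eq hp hp8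
  have hT : Ideal.span {(2 : ℤ√(-(p : ℤ))), ⟨1, 1⟩} ∈ nonZeroDivisors (Ideal (ℤ√(-(p : ℤ)))) := by
    rw [mem_nonZeroDivisors_iff_ne_zero, Ne, Ideal.zero_eq_bot, Ideal.span_eq_bot]
    intro h
    exact two_ne_zero (h 2 (by simp))
  have hA : Ideal.span {(a : ℤ√(-(p : ℤ))), ⟨x, 1⟩} ∈ nonZeroDivisors (Ideal (ℤ√(-(p : ℤ)))) := by
    rw [mem_nonZeroDivisors_iff_ne_zero, Ne, Ideal.zero_eq_bot, Ideal.span_eq_bot]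
    intro h
    exact ha (by exact_mod_cast h a (by simp))
  refine ⟨ClassGroup.mk0 ⟨_, hA⟩, ClassGroup.mk0 ⟨_, hT⟩, ?_, ?_, ?_, ?_⟩
  · intro c hc
    obtain ⟨⟨I, hI⟩, rfl⟩ := ClassGroup.mk0_surjective c
    rw [← map_pow, SubmonoidClass.mk_pow, ClassGroup.mk0_eq_one_iff] at hc
    obtain ⟨x, y, hx, hy, h⟩ := eq_or_exists_of_sq_eq_span_singleton hp hp4
      (mem_nonZeroDivisors_iff_ne_zero.mp hI) hc
    refine h.imp (fun h ↦ ?_) fun h ↦ ClassGroup.mk0_eq_mk0_iff.mpr ⟨y, x, hy, hx, h⟩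
    rw [← map_one ClassGroup.mk0]
    exact ClassGroup.mk0_eq_mk0_iff.mpr ⟨y, x, hy, hx, by simpa using h⟩
  · rw [Ne, ClassGroup.mk0_eq_one_iff]
    exact not_isPrincipal_span_two hp hp8
  · rw [← map_pow, SubmonoidClass.mk_pow, ClassGroup.mk0_eq_one_iff]
    exact ⟨2, span_two_sq hp4⟩
  · rw [← map_pow, ← map_mul, SubmonoidClass.mk_pow, MulMemClass.mk_mul_mk,
      ClassGroup.mk0_eq_one_iff]
    exact ⟨_, hax⟩

end Zsqrtd

theorem Qsqrtneg.sqrt_sq (p : ℕ) :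
    (Complex.I * Real.sqrt p : ℂ) * (Complex.I * Real.sqrt p) = -p := by
  rw [mul_mul_mul_comm, Complex.I_mul_I, ← Complex.ofReal_mul, Real.mul_self_sqrt p.cast_nonneg]
  simp

/-- The generator `√-p` of `ℚ(√-p)`. -/
noncomputable def Qsqrtneg.gen (p : ℕ) : Qsqrtneg p :=
  ⟨Complex.I * Real.sqrt p, mem_adjoin_simple_self ℚ _⟩

theorem Qsqrtneg.gen_mul_gen (p : ℕ) : gen p * gen p = ((-(p : ℤ) : ℤ) : Qsqrtneg p) := by
  apply Subtype.ext
  simpa [gen] using sqrt_sq p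

noncomputable instance Qsqrtneg.algebraZsqrtd (p : ℕ) : Algebra (ℤ√(-(p : ℤ))) (Qsqrtneg p) :=
  (Zsqrtd.lift ⟨gen p, gen_mul_gen p⟩).toAlgebra

theorem Qsqrtneg.algebraMap_apply (p : ℕ) (z : ℤ√(-(p : ℤ))) :
    algebraMap (ℤ√(-(p : ℤ))) (Qsqrtneg p) z = z.re + z.im * gen p := rfl

theorem Qsqrtneg.coe_rat_add_rat_mul_gen (p : ℕ) (a b : ℚ) :
    (((a : Qsqrtneg p) + b * gen p : Qsqrtneg p) : ℂ) = ⟨a, b * Real.sqrt p⟩ := by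
  apply Complex.ext <;> simp [gen]

theorem Qsqrtneg.exists_rat_add_rat_mul_gen {p : ℕ} (z : Qsqrtneg p) :
    ∃ a b : ℚ, z = a + b * gen p := by
  have halg : IsAlgebraic ℚ (Complex.I * Real.sqrt p : ℂ) := by
    refine IsIntegral.isAlgebraic ⟨Polynomial.X ^ 2 + Polynomial.C (p : ℚ), by monicity!, ?_⟩
    rw [Polynomial.eval₂_add, Polynomial.eval₂_X_pow, Polynomial.eval₂_C, sq, sqrt_sq]
    simp
  obtain ⟨z, hz⟩ := z
  suffices H : ∃ a b : ℚ, z = a + b * (Complex.I * Real.sqrt p) by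
    obtain ⟨a, b, h⟩ := H
    exact ⟨a, b, Subtype.ext (by simpa [gen] using h)⟩
  rw [Qsqrtneg, ← mem_toSubalgebra, adjoin_simple_toSubalgebra_of_isAlgebraic halg] at hz
  induction hz using Algebra.adjoin_induction with
  | mem x hx =>
    obtain rfl := Set.mem_singleton_iff.mp hx
    exact ⟨0, 1, by simp⟩
  | algebraMap r => exact ⟨r, 0, by simp⟩
  | add x y _ _ hx hy =>
    obtain ⟨a, b, rfl⟩ := hx
    obtain ⟨a', b', rfl⟩ := hy
    exact ⟨a + a', b + b', by push_cast; ring⟩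
  | mul x y _ _ hx hy =>
    obtain ⟨a, b, rfl⟩ := hx
    obtain ⟨a', b', rfl⟩ := hy
    refine ⟨a * a' - p * (b * b'), a * b' + a' * b, ?_⟩
    push_cast
    linear_combination (b * b' : ℂ) * sqrt_sq p

theorem Rat.exists_int_of_sq {r : ℚ} {n : ℤ} (h : r ^ 2 = n) : ∃ m : ℤ, r = m := by
  refine ⟨r.num, (Rat.coe_int_num_of_den_eq_one ?_).symm⟩
  have : (r ^ 2).den = 1 := by rw [h, Rat.den_intCast]
  rw [Rat.den_pow] at this
  exact (Nat.pow_eq_one.mp this).resolve_right two_ne_zero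

theorem Rat.exists_int_of_two_mul_of_sq_add {p : ℕ} (hp : p.Prime) (hp4 : p % 4 = 1) {a b : ℚ}
    {m n : ℤ} (hm : 2 * a = m) (hn : a ^ 2 + p * b ^ 2 = n) : ∃ x y : ℤ, a = x ∧ b = y := by
  have hpp : Prime (p : ℤ) := Nat.prime_iff_prime_int.mp hp
  have h1 : (2 * b * p) ^ 2 = ((p * (4 * n - m ^ 2) : ℤ) : ℚ) := by
    push_cast
    rw [← hm, ← hn]
    ring
  obtain ⟨k, hk⟩ := Rat.exists_int_of_sq h1
  have h2 : k ^ 2 = p * (4 * n - m ^ 2) := by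
    rw [hk] at h1
    exact_mod_cast h1
  obtain ⟨l, rfl⟩ := hpp.dvd_of_dvd_pow (Dvd.intro _ h2.symm)
  have h3 : p * l ^ 2 + m ^ 2 = 4 * n := by
    apply mul_left_cancel₀ hpp.ne_zero
    linear_combination h2
  have hl : 2 * b = l := by
    have hp0 : (p : ℚ) ≠ 0 := by exact_mod_cast hp.ne_zero
    apply mul_right_cancel₀ hp0
    rw [hk]
    push_cast
    ring
  obtain ⟨j, hj⟩ : ∃ j : ℤ, (p : ℤ) = 4 * j + 1 := ⟨p / 4, by omega⟩
  have h4 : l ^ 2 + m ^ 2 = 4 * (n - j * l ^ 2) := by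
    rw [hj] at h3
    linear_combination h3
  rcases Int.even_or_odd' m with ⟨x, rfl | rfl⟩ <;> rcases Int.even_or_odd' l with ⟨y, rfl | rfl⟩
  · refine ⟨x, y, ?_, ?_⟩
    · push_cast at hm
      linarith
    · push_cast at hl
      linarith
  all_goals
    ring_nf at h4
    omega

theorem Qsqrtneg.algebraMap_injective {p : ℕ} (hp : p.Prime) :
    Function.Injective (algebraMap (ℤ√(-(p : ℤ))) (Qsqrtneg p)) := by
  rw [injective_iff_map_eq_zero]
  intro z hz
  have h := congrArg (Subtype.val) hz
  have h' := coe_rat_add_rat_mul_gen p z.re z.im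
  rw [algebraMap_apply] at h
  push_cast at h'
  have h'' := h'.symm.trans h
  rw [Complex.ext_iff] at h''
  have hp0 : Real.sqrt p ≠ 0 := (Real.sqrt_pos.mpr (by exact_mod_cast hp.pos)).ne'
  ext
  · simpa using h''.1
  · simpa [hp0, hp.ne_zero] using h''.2

theorem Qsqrtneg.isIntegralClosure {p : ℕ} (hp : p.Prime) (hp4 : p % 4 = 1) :
    IsIntegralClosure (ℤ√(-(p : ℤ))) ℤ (Qsqrtneg p) where
  algebraMap_injective := algebraMap_injective hp
  isIntegral_iff {z} := by
    constructor
    · intro hz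
      obtain ⟨a, b, rfl⟩ := exists_rat_add_rat_mul_gen z
      have h1 : IsIntegral ℤ (⟨a, b * Real.sqrt p⟩ : ℂ) := by
        rw [← coe_rat_add_rat_mul_gen]
        exact hz.map ((Qsqrtneg p).val.restrictScalars ℤ)
      have h2 : IsIntegral ℤ (starRingEnd ℂ ⟨a, b * Real.sqrt p⟩) :=
        map_isIntegral_int (starRingEnd ℂ) h1
      have h3 : IsIntegral ℤ ((2 * a : ℚ) : ℂ) := by
        have : ((2 * a : ℚ) : ℂ) = ⟨a, b * Real.sqrt p⟩ + starRingEnd ℂ ⟨a, b * Real.sqrt p⟩ := by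
          rw [Complex.add_conj]
          push_cast
          rfl
        rw [this]
        exact h1.add h2
      have h4 : IsIntegral ℤ ((a ^ 2 + p * b ^ 2 : ℚ) : ℂ) := by
        have : ((a ^ 2 + p * b ^ 2 : ℚ) : ℂ) =
            ⟨a, b * Real.sqrt p⟩ * starRingEnd ℂ ⟨a, b * Real.sqrt p⟩ := by
          rw [Complex.mul_conj, Complex.normSq_mk, mul_mul_mul_comm,
            Real.mul_self_sqrt p.cast_nonneg]
          push_cast
          ring
        rw [this]
        exact h1.mul h2
      have key (r : ℚ) (hr : IsIntegral ℤ (r : ℂ)) : ∃ n : ℤ, r = n := by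
        have : IsIntegral ℤ r :=
          (isIntegral_algebraMap_iff (algebraMap ℚ ℂ).injective).mp (by simpa using hr)
        obtain ⟨n, hn⟩ := IsIntegrallyClosed.isIntegral_iff.mp this
        exact ⟨n, by simpa using hn.symm⟩
      obtain ⟨m, hm⟩ := key _ h3
      obtain ⟨n, hn⟩ := key _ h4
      obtain ⟨x, y, rfl, rfl⟩ := Rat.exists_int_of_two_mul_of_sq_add hp hp4 hm hn
      exact ⟨⟨x, y⟩, by simp [algebraMap_apply]⟩
    · rintro ⟨z, rfl⟩
      have hgen : IsIntegral ℤ (gen p) := by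
        refine ⟨Polynomial.X ^ 2 + Polynomial.C (p : ℤ), by monicity!, ?_⟩
        rw [Polynomial.eval₂_add, Polynomial.eval₂_X_pow, Polynomial.eval₂_C, sq, gen_mul_gen]
        simp
      rw [algebraMap_apply]
      exact (isIntegral_algebraMap (R := ℤ) (x := z.re)).add
        ((isIntegral_algebraMap (R := ℤ) (x := z.im)).mul hgen)

/-- For a prime `p ≡ 1 mod 8`, the `2`-Sylow subgroup of the class group of `ℚ(√-p)` is
cyclic of order divisible by `4`; in particular `4` divides the class number. -/
theorem two_sylow_classgroup_cyclic_of_prime_one_mod_eight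
    (p : ℕ) (hp : p.Prime) (hp8 : p % 8 = 1)
    [NumberField (Qsqrtneg p)] :
    (∀ P : Sylow 2 (ClassGroup (𝓞 (Qsqrtneg p))),
      IsCyclic P ∧ 4 ∣ Nat.card P) ∧
    4 ∣ NumberField.classNumber (Qsqrtneg p) := by
  have hp4 : p % 4 = 1 := by omega
  have := Qsqrtneg.isIntegralClosure hp hp4
  have : IsDomain (ℤ√(-(p : ℤ))) := (Qsqrtneg.algebraMap_injective hp).isDomain _
  have : IsDedekindDomain (ℤ√(-(p : ℤ))) :=
    IsIntegralClosure.isDedekindDomain ℤ ℚ (Qsqrtneg p) (ℤ√(-(p : ℤ)))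
  let f : ClassGroup (ℤ√(-(p : ℤ))) ≃* ClassGroup (𝓞 (Qsqrtneg p)) :=
    (ClassGroup.mulEquiv (RingOfIntegers.equiv (K := Qsqrtneg p) (ℤ√(-(p : ℤ))))).symm
  obtain ⟨s, t, ht, ht1, ht2, hst⟩ := Zsqrtd.exists_classGroup_structure hp hp8
  have key := sylow_two_isCyclic_and_four_dvd_card (s := f s) (t := f t)
    (fun c hc ↦ by
      obtain ⟨c, rfl⟩ := f.surjective c
      rw [← map_pow, map_eq_one_iff f f.injective] at hc
      rw [map_eq_one_iff f f.injective, f.injective.eq_iff]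
      exact ht c hc)
    (by rwa [Ne, map_eq_one_iff f f.injective])
    (by rw [← map_pow, ht2, map_one]) (by rw [← map_pow, ← map_mul, hst, map_one])
  refine ⟨key, ?_⟩
  obtain ⟨P⟩ : Nonempty (Sylow 2 (ClassGroup (𝓞 (Qsqrtneg p)))) := inferInstance
  rw [classNumber, ← Nat.card_eq_fintype_card]
  exact (key P).2.trans (Subgroup.card_subgroup_dvd_card _)
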